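/- arXiv:2408.10456 — 2 statements merged into one kernel-verified Lean document; each statement's English description precedes it below -/
import Mathlib

section
/- Let r > 0, s > 0, set σ = 2s/r, let α > 1, and let u, v ∈ ℝ^p satisfy ‖u‖ ≤ r, ‖v‖ ≤ r, and ‖u − v‖ ≤ r. Then for every integer k ≥ 3, Σ_{j=0}^{k} (−1)^{k−j}·binom(k,j)·(∏_{ℓ=0}^{j−1}(α−ℓ))·(∏_{ℓ=0}^{k−j−1}(α+ℓ−1)) · ∫_{ℝ^p} (N_{u,s²}(θ)/N_{0,s²}(θ) − 1)^j · (N_{v,s²}(θ)/N_{0,s²}(θ) − 1)^{k−j} · N_{0,s²}(θ) dθ ≤ F̃_{α,σ,k}. (The left-hand side equals the k-th derivative at q = 0 of F_α(q) = ∫ (q·N_{u,s²} + (1−q)·N_{0,s²})^α · (q·N_{v,s²} + (1−q)·N_{0,s²})^{1−α} dθ.) -/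
open MeasureTheory Finset

noncomputable section

/-- `p`-dimensional Gaussian density with mean `μ` and covariance `s² I`. -/
def gaussND {p : ℕ} (μ : EuclideanSpace ℝ (Fin p)) (s : ℝ)
    (x : EuclideanSpace ℝ (Fin p)) : ℝ :=
  (2 * Real.pi * s ^ 2) ^ (-(p : ℝ) / 2) * Real.exp (-‖x - μ‖ ^ 2 / (2 * s ^ 2))

/-- one-dimensional Gaussian density with mean `μ` and variance `s²`. -/
def gauss1 (μ s θ : ℝ) : ℝ :=
  (2 * Real.pi * s ^ 2) ^ (-(1 : ℝ) / 2) * Real.exp (-(θ - μ) ^ 2 / (2 * s ^ 2))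

/-- Rényi divergence of order `α` between densities `P` and `Q` w.r.t. the measure `ν`. -/
def renyiDiv {Ω : Type*} [MeasurableSpace Ω] (ν : Measure Ω) (α : ℝ) (P Q : Ω → ℝ) : ℝ :=
  (α - 1)⁻¹ * Real.log (∫ x, (P x / Q x) ^ α * Q x ∂ν)

/-- `M_{σ,k} = ∫ (N_{1,σ²/4}/N_{0,σ²/4} − 1)^k N_{0,σ²/4}`. -/
def Mcoef (σ : ℝ) (k : ℕ) : ℝ :=
  ∫ θ : ℝ, (gauss1 1 (σ / 2) θ / gauss1 0 (σ / 2) θ - 1) ^ k * gauss1 0 (σ / 2) θ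

/-- `B̃_{σ,j}`. -/
def Btil (σ : ℝ) (j : ℕ) : ℝ :=
  if Even j then Mcoef σ j else Real.sqrt (Mcoef σ (j - 1) * Mcoef σ (j + 1))

/-- `H_{α,σ}(q)`. -/
def Hfun (α σ q : ℝ) : ℝ :=
  ∫ θ : ℝ, (q * (gauss1 1 (σ / 2) θ / gauss1 0 (σ / 2) θ) + (1 - q)) ^ α * gauss1 0 (σ / 2) θ

/-- `R̃_{α,σ,3}(q)`. -/
def Rtil3 (α σ q : ℝ) : ℝ :=
  if 3 < α then
    q ^ 3 * α * (α - 1) * |α - 2| *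
      ((∑ ℓ ∈ Finset.range (⌈α⌉₊ - 3 + 1),
          q ^ ℓ * ((⌈α⌉₊ - 3).factorial : ℝ) /
            (((⌈α⌉₊ - 3 - ℓ).factorial : ℝ) * ((3 + ℓ).factorial : ℝ)) * Btil σ (ℓ + 3)) +
        1 / 6 * Btil σ 3)
  else
    q ^ 3 * α * (α - 1) * |α - 2| * (1 / 6 * (1 - q) ^ (α - 3) * Btil σ 3)

/-- `F̃_{α,σ,k}`. -/
def Ftil (α σ : ℝ) (k : ℕ) : ℝ :=
  (α - 1) * α ^ (k - 1) *
      (if Even k then 4 * Mcoef σ k else 3 * Real.sqrt (Mcoef σ (k - 1) * Mcoef σ (k + 1))) +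
    (α - 1) * α ^ (k - 1) *
      ∑ j ∈ Finset.range (k + 1),
        (k.choose j : ℝ) *
          |α / (α - 1) * (∏ ℓ ∈ Finset.range j, (1 - (ℓ : ℝ) / α)) *
              (∏ ℓ ∈ Finset.range (k - j), (1 + ((ℓ : ℝ) - 1) / α)) - 1| *
          Btil σ k

/-- `Ẽ_{α,σ,m}(q)`. -/
def Etil (α σ : ℝ) (m : ℕ) (q : ℝ) : ℝ :=
  (q ^ m / (m.factorial : ℝ)) *
    ∑ j ∈ Finset.range (m + 1),
      (1 - q) ^ (-(α + (m : ℝ) - (j : ℝ) - 1)) * (m.choose j : ℝ) *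
        (∏ ℓ ∈ Finset.range j, |α - (ℓ : ℝ)|) *
        (∏ ℓ ∈ Finset.range (m - j), (α + (ℓ : ℝ) - 1)) *
        (if α ≤ (j : ℝ) then (1 - q) ^ (α - (j : ℝ)) * Btil σ m
         else Btil σ m + ∑ ℓ ∈ Finset.range (⌈α⌉₊ - j + 1),
           q ^ ℓ * ((⌈α⌉₊ - j).factorial : ℝ) * (m.factorial : ℝ) /
             (((⌈α⌉₊ - j - ℓ).factorial : ℝ) * ((m + ℓ).factorial : ℝ)) * Btil σ (ℓ + m))

/-- Gaussian density with mean `μ` and covariance `s² I` on a finite-dimensional inner product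
space. -/
def gaussV {V : Type*} [NormedAddCommGroup V] [InnerProductSpace ℝ V] (μ : V) (s : ℝ) (x : V) : ℝ :=
  (2 * Real.pi * s ^ 2) ^ (-(Module.finrank ℝ V : ℝ) / 2) * Real.exp (-‖x - μ‖ ^ 2 / (2 * s ^ 2))

theorem gaussND_eq_gaussV {p : ℕ} (μ : EuclideanSpace ℝ (Fin p)) (s : ℝ) :
    gaussND μ s = gaussV μ s := by
  ext x
  simp [gaussND, gaussV]

theorem gauss1_eq_gaussV (μ s : ℝ) : gauss1 μ s = gaussV μ s := by
  ext x
  simp [gauss1, gaussV]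

section Combinatorics

variable {ι : Type*} [Fintype ι] [DecidableEq ι]

theorem sum_neg_one_pow_card_compl_nonneg (A : Finset ι) :
    0 ≤ ∑ S : Finset ι, if A ⊆ S then (-1 : ℝ) ^ #Sᶜ else 0 := by
  have h : ∑ S : Finset ι, (if A ⊆ S then (-1 : ℝ) ^ #Sᶜ else 0)
      = ∑ U ∈ Aᶜ.powerset, (-1 : ℝ) ^ #U := by
    rw [← Finset.sum_filter]
    refine Finset.sum_bij' (fun S _ => Sᶜ) (fun U _ => Uᶜ) ?_ ?_ ?_ ?_ ?_
    · intro S hS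
      simpa using hS
    · intro U hU
      simp only [Finset.mem_powerset] at hU
      simpa using Finset.subset_compl_comm.mp hU
    · simp
    · simp
    · simp
  have h2 := Finset.sum_powerset_neg_one_pow_card (x := Aᶜ)
  have h3 : ∑ U ∈ Aᶜ.powerset, (-1 : ℝ) ^ #U = ((if Aᶜ = ∅ then 1 else 0 : ℤ) : ℝ) := by
    rw [← h2]; push_cast; rfl
  rw [h, h3]
  split_ifs <;> simp

theorem subset_offDiag_iff {T : Finset (ι × ι)} (hT : T ⊆ (Finset.univ : Finset ι).offDiag)
    (S : Finset ι) : T ⊆ S.offDiag ↔ T.image Prod.fst ∪ T.image Prod.snd ⊆ S := by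
  constructor
  · intro h a ha
    simp only [Finset.mem_union, Finset.mem_image] at ha
    rcases ha with ⟨p, hp, rfl⟩ | ⟨p, hp, rfl⟩
    · exact (Finset.mem_offDiag.mp (h hp)).1
    · exact (Finset.mem_offDiag.mp (h hp)).2.1
  · intro h p hp
    refine Finset.mem_offDiag.mpr ⟨h ?_, h ?_, (Finset.mem_offDiag.mp (hT hp)).2.2⟩
    · exact Finset.mem_union_left _ (Finset.mem_image_of_mem _ hp)
    · exact Finset.mem_union_right _ (Finset.mem_image_of_mem _ hp)

/-- Expansion of an alternating sum over induced subgraphs as a sum over edge sets. -/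
theorem alternating_sum_prod_offDiag (w : ι × ι → ℝ) :
    ∑ S : Finset ι, (-1 : ℝ) ^ #Sᶜ * ∏ p ∈ S.offDiag, (1 + w p) =
      ∑ T ∈ (Finset.univ : Finset ι).offDiag.powerset, (∏ p ∈ T, w p) *
        ∑ S : Finset ι, if T.image Prod.fst ∪ T.image Prod.snd ⊆ S then (-1 : ℝ) ^ #Sᶜ else 0 := by
  have h : ∀ S : Finset ι, (-1 : ℝ) ^ #Sᶜ * ∏ p ∈ S.offDiag, (1 + w p) =
      ∑ T ∈ (Finset.univ : Finset ι).offDiag.powerset, (∏ p ∈ T, w p) *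
        if T.image Prod.fst ∪ T.image Prod.snd ⊆ S then (-1 : ℝ) ^ #Sᶜ else 0 := by
    intro S
    rw [Finset.prod_one_add, Finset.mul_sum]
    have hsub : S.offDiag.powerset ⊆ (Finset.univ : Finset ι).offDiag.powerset :=
      Finset.powerset_mono.mpr (Finset.offDiag_mono (Finset.subset_univ S))
    rw [← Finset.sum_subset_zero_on_sdiff hsub (f := fun T => (-1 : ℝ) ^ #Sᶜ * ∏ p ∈ T, w p)]
    · intro T hT
      rw [Finset.mem_sdiff, Finset.mem_powerset, Finset.mem_powerset] at hT
      rw [if_neg (mt (subset_offDiag_iff hT.1 S).mpr hT.2), mul_zero]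
    · intro T hT
      rw [Finset.mem_powerset] at hT
      have hT' := hT.trans (Finset.offDiag_mono (Finset.subset_univ S))
      rw [if_pos ((subset_offDiag_iff hT' S).mp hT), mul_comm]
  simp_rw [h, Finset.mul_sum]
  exact Finset.sum_comm

theorem abs_alternating_sum_prod_offDiag_le (w W : ι × ι → ℝ) (hw : ∀ p, |w p| ≤ W p) :
    |∑ S : Finset ι, (-1 : ℝ) ^ #Sᶜ * ∏ p ∈ S.offDiag, (1 + w p)| ≤
      ∑ S : Finset ι, (-1 : ℝ) ^ #Sᶜ * ∏ p ∈ S.offDiag, (1 + W p) := by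
  rw [alternating_sum_prod_offDiag, alternating_sum_prod_offDiag]
  refine (Finset.abs_sum_le_sum_abs _ _).trans (Finset.sum_le_sum fun T _ => ?_)
  rw [abs_mul, abs_of_nonneg (sum_neg_one_pow_card_compl_nonneg _), Finset.abs_prod]
  exact mul_le_mul_of_nonneg_right
    (Finset.prod_le_prod (fun p _ => abs_nonneg _) fun p _ => hw p)
    (sum_neg_one_pow_card_compl_nonneg _)

end Combinatorics

theorem abs_exp_sub_one_le_of_abs_le {a b : ℝ} (h : |a| ≤ b) :
    |Real.exp a - 1| ≤ Real.exp b - 1 := by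
  obtain ⟨h1, h2⟩ := abs_le.mp h
  rw [abs_le]
  constructor
  · have h3 := Real.add_one_le_exp (a / 2)
    have h4 : Real.exp (-b) ≤ Real.exp a := Real.exp_le_exp.mpr h1
    have h5 : Real.exp (-b) * Real.exp b = 1 := by rw [← Real.exp_add]; simp
    nlinarith [Real.exp_pos b, Real.exp_pos (-b), sq_nonneg (Real.exp b - 1),
      sq_nonneg (Real.exp b - Real.exp (-b))]
  · linarith [Real.exp_le_exp.mpr h2]

/-- Comparison of `(a/c - b/c)^k c` with moments relative to the reference densities `c` and `b`,
for `b ≤ a`. -/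
theorem pow_sub_mul_le {a b c : ℝ} (hb : 0 < b) (hc : 0 < c) (hab : b ≤ a) {k : ℕ}
    (hk : 1 ≤ k) :
    (a / c - b / c) ^ k * c ≤ |a / c - 1| ^ k * c + |a / b - 1| ^ k * b := by
  have h0 : 0 ≤ a / c - b / c := by
    rw [← sub_div]; exact div_nonneg (by linarith) hc.le
  rcases le_total c b with hcb | hcb
  · have h1 : 1 ≤ b / c := (one_le_div hc).mpr hcb
    have h2 : (a / c - b / c) ^ k ≤ |a / c - 1| ^ k :=
      pow_le_pow_left₀ h0 (le_trans (by linarith) (le_abs_self _)) k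
    have := mul_le_mul_of_nonneg_right h2 hc.le
    have : 0 ≤ |a / b - 1| ^ k * b := by positivity
    linarith
  · have h1 : b / c ≤ 1 := (div_le_one hc).mpr hcb
    have h3 : 0 ≤ a / b - 1 := by
      have := (one_le_div hb).mpr hab
      linarith
    have h2 : (a / c - b / c) ^ k * c = (b / c) ^ k * c * (a / b - 1) ^ k := by
      rw [mul_right_comm, ← mul_pow]
      congr 2
      field_simp
    have h4 : (b / c) ^ k * c ≤ b := by
      calc (b / c) ^ k * c ≤ (b / c) * c :=
            mul_le_mul_of_nonneg_right (pow_le_of_le_one (by positivity) h1 (by omega)) hc.le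
        _ = b := by field_simp
    rw [h2, abs_of_nonneg h3]
    have := mul_le_mul_of_nonneg_right h4 (pow_nonneg h3 k)
    have : 0 ≤ |a / c - 1| ^ k * c := by positivity
    linarith

section GaussianIntegrals

variable {V : Type*} [NormedAddCommGroup V] [InnerProductSpace ℝ V]

theorem gaussV_pos (μ : V) {s : ℝ} (hs : 0 < s) (x : V) : 0 < gaussV μ s x := by
  unfold gaussV
  have := Real.pi_pos
  positivity

theorem gaussV_div (u v : V) {s : ℝ} (hs : 0 < s) (x : V) :
    gaussV u s x / gaussV v s x = Real.exp ((‖x - v‖ ^ 2 - ‖x - u‖ ^ 2) / (2 * s ^ 2)) := by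
  have h : (0 : ℝ) < (2 * Real.pi * s ^ 2) ^ (-(Module.finrank ℝ V : ℝ) / 2) := by
    have := Real.pi_pos
    positivity
  rw [gaussV, gaussV, mul_div_mul_left _ _ h.ne', ← Real.exp_sub]
  congr 1
  ring

theorem prod_gaussV_div_mul {ι : Type*} [DecidableEq ι] (u : ι → V) {s : ℝ} (hs : 0 < s)
    (S : Finset ι) (x : V) :
    (∏ a ∈ S, gaussV (u a) s x / gaussV 0 s x) * gaussV 0 s x =
      (∏ p ∈ S.offDiag, Real.exp (inner ℝ (u p.1) (u p.2) / (2 * s ^ 2))) *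
        gaussV (∑ a ∈ S, u a) s x := by
  simp_rw [gaussV_div _ _ hs, ← Real.exp_sum, gaussV]
  rw [mul_left_comm, mul_left_comm (Real.exp _), ← Real.exp_add, ← Real.exp_add]
  congr 2
  have h1 : ∑ p ∈ S.offDiag, inner ℝ (u p.1) (u p.2) =
      ‖∑ a ∈ S, u a‖ ^ 2 - ∑ a ∈ S, ‖u a‖ ^ 2 := by
    rw [← real_inner_self_eq_norm_sq, sum_inner]
    simp_rw [inner_sum]
    rw [← Finset.sum_product', ← Finset.diag_union_offDiag,
      Finset.sum_union (Finset.disjoint_diag_offDiag S), Finset.sum_diag]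
    simp_rw [real_inner_self_eq_norm_sq]
    ring
  rw [← Finset.sum_div, ← Finset.sum_div, h1]
  have h2 : ∑ a ∈ S, (‖x - 0‖ ^ 2 - ‖x - u a‖ ^ 2) =
      2 * inner ℝ x (∑ a ∈ S, u a) - ∑ a ∈ S, ‖u a‖ ^ 2 := by
    rw [inner_sum, Finset.mul_sum, ← Finset.sum_sub_distrib]
    refine Finset.sum_congr rfl fun a _ => ?_
    rw [norm_sub_sq_real x (u a), sub_zero]
    ring
  rw [h2, norm_sub_sq_real x (∑ a ∈ S, u a), sub_zero]
  ring

theorem prod_gaussV_div_sub_one_mul {ι : Type*} [Fintype ι] [DecidableEq ι] (u : ι → V) {s : ℝ}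
    (hs : 0 < s) (x : V) :
    (∏ a, (gaussV (u a) s x / gaussV 0 s x - 1)) * gaussV 0 s x =
      ∑ S : Finset ι, ((-1 : ℝ) ^ #Sᶜ *
        ∏ p ∈ S.offDiag, Real.exp (inner ℝ (u p.1) (u p.2) / (2 * s ^ 2))) *
          gaussV (∑ a ∈ S, u a) s x := by
  simp_rw [sub_eq_add_neg]
  rw [Fintype.prod_add, Finset.sum_mul]
  refine Finset.sum_congr rfl fun S _ => ?_
  rw [Finset.prod_const, mul_assoc, mul_assoc, ← prod_gaussV_div_mul u hs]
  ring

theorem abs_pow_gaussV_div_sub_one_mul_translate (u v : V) (s : ℝ) (k : ℕ) (x : V) :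
    |gaussV u s x / gaussV v s x - 1| ^ k * gaussV v s x =
      (fun y => |gaussV (u - v) s y / gaussV 0 s y - 1| ^ k * gaussV 0 s y) (x - v) := by
  simp [gaussV]

theorem pow_sub_gaussV_div_mul (u v : V) (s : ℝ) (k : ℕ) (x : V) :
    (gaussV u s x / gaussV 0 s x - gaussV v s x / gaussV 0 s x) ^ k * gaussV 0 s x =
      ∑ j ∈ Finset.range (k + 1), ((-1 : ℝ) ^ (k - j) * (k.choose j : ℝ)) *
        ((gaussV u s x / gaussV 0 s x - 1) ^ j * (gaussV v s x / gaussV 0 s x - 1) ^ (k - j) *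
          gaussV 0 s x) := by
  rw [show gaussV u s x / gaussV 0 s x - gaussV v s x / gaussV 0 s x =
    (gaussV u s x / gaussV 0 s x - 1) + -(gaussV v s x / gaussV 0 s x - 1) by ring, add_pow,
    Finset.sum_mul]
  refine Finset.sum_congr rfl fun j _ => ?_
  rw [neg_pow (gaussV v s x / gaussV 0 s x - 1)]
  ring

variable [FiniteDimensional ℝ V] [MeasurableSpace V] [BorelSpace V]

theorem integrable_gaussV (μ : V) {s : ℝ} (hs : 0 < s) : Integrable (gaussV μ s) := by
  have h : Integrable fun x : V => Real.exp (-(1 / (2 * s ^ 2)) * ‖x‖ ^ 2) := by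
    have hb : 0 < ((1 / (2 * s ^ 2) : ℝ) : ℂ).re := by
      rw [Complex.ofReal_re]; positivity
    have := (GaussianFourier.integrable_cexp_neg_mul_sq_norm_add (V := V) hb 0 0).re
    refine this.congr (Filter.Eventually.of_forall fun x => ?_)
    simp only [zero_mul, add_zero]
    rw [← Complex.ofReal_neg, ← Complex.ofReal_pow, ← Complex.ofReal_mul, ← Complex.ofReal_exp]
    rfl
  have h2 := (h.comp_sub_right μ).const_mul
    ((2 * Real.pi * s ^ 2) ^ (-(Module.finrank ℝ V : ℝ) / 2))
  refine h2.congr (Filter.Eventually.of_forall fun x => ?_)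
  simp only [gaussV]
  congr 2
  ring

theorem integral_gaussV (μ : V) {s : ℝ} (hs : 0 < s) : ∫ x, gaussV μ s x = 1 := by
  have hb : (0 : ℝ) < 1 / (2 * s ^ 2) := by positivity
  have h := GaussianFourier.integral_rexp_neg_mul_sq_norm (V := V) hb
  have h2 : ∀ x : V, gaussV μ s x = (2 * Real.pi * s ^ 2) ^ (-(Module.finrank ℝ V : ℝ) / 2) *
      (fun y : V => Real.exp (-(1 / (2 * s ^ 2)) * ‖y‖ ^ 2)) (x - μ) := by
    intro x
    simp only [gaussV]
    congr 2
    ring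
  simp_rw [h2]
  rw [integral_const_mul,
    integral_sub_right_eq_self (fun y : V => Real.exp (-(1 / (2 * s ^ 2)) * ‖y‖ ^ 2)), h]
  have hc : (0 : ℝ) < 2 * Real.pi * s ^ 2 := by
    have := Real.pi_pos
    positivity
  have h3 : Real.pi / (1 / (2 * s ^ 2)) = 2 * Real.pi * s ^ 2 := by
    field_simp
  rw [h3, ← Real.rpow_add hc]
  rw [show -(Module.finrank ℝ V : ℝ) / 2 + (Module.finrank ℝ V : ℝ) / 2 = 0 by ring,
    Real.rpow_zero]

theorem integrable_prod_gaussV_div_sub_one_mul {ι : Type*} [Fintype ι] (u : ι → V)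
    {s : ℝ} (hs : 0 < s) :
    Integrable fun x => (∏ a, (gaussV (u a) s x / gaussV 0 s x - 1)) * gaussV 0 s x := by
  classical
  simp_rw [prod_gaussV_div_sub_one_mul u hs]
  exact integrable_finsetSum _ fun S _ => (integrable_gaussV _ hs).const_mul _

theorem integral_prod_gaussV_div_sub_one_mul {ι : Type*} [Fintype ι] [DecidableEq ι] (u : ι → V)
    {s : ℝ} (hs : 0 < s) :
    ∫ x, (∏ a, (gaussV (u a) s x / gaussV 0 s x - 1)) * gaussV 0 s x =
      ∑ S : Finset ι, (-1 : ℝ) ^ #Sᶜ *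
        ∏ p ∈ S.offDiag, Real.exp (inner ℝ (u p.1) (u p.2) / (2 * s ^ 2)) := by
  simp_rw [prod_gaussV_div_sub_one_mul u hs]
  rw [integral_finsetSum _ fun S _ => (integrable_gaussV _ hs).const_mul _]
  simp_rw [integral_const_mul, integral_gaussV _ hs, mul_one]

theorem Mcoef_eq (ι : Type*) [Fintype ι] [DecidableEq ι] {r s : ℝ} (hr : 0 < r) (hs : 0 < s) :
    Mcoef (2 * s / r) (Fintype.card ι) =
      ∑ S : Finset ι, (-1 : ℝ) ^ #Sᶜ * ∏ _p ∈ S.offDiag, Real.exp (r ^ 2 / (2 * s ^ 2)) := by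
  have hσ : (0 : ℝ) < 2 * s / r / 2 := by positivity
  have h := integral_prod_gaussV_div_sub_one_mul (fun _ : ι => (1 : ℝ)) hσ
  simp only [Finset.prod_const, Finset.card_univ] at h
  rw [Mcoef]
  simp_rw [gauss1_eq_gaussV]
  rw [h]
  refine Finset.sum_congr rfl fun S _ => ?_
  rw [Finset.prod_const]
  congr 3
  simp
  field_simp

/-- Mixed moments of centred likelihood ratios are maximised in the one-dimensional case. -/
theorem abs_integral_prod_gaussV_div_sub_one_mul_le {ι : Type*} [Fintype ι] (u : ι → V)
    {r s : ℝ} (hr : 0 < r) (hs : 0 < s) (hu : ∀ a, ‖u a‖ ≤ r) :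
    |∫ x, (∏ a, (gaussV (u a) s x / gaussV 0 s x - 1)) * gaussV 0 s x| ≤
      Mcoef (2 * s / r) (Fintype.card ι) := by
  classical
  rw [integral_prod_gaussV_div_sub_one_mul u hs, Mcoef_eq ι hr hs]
  have h := abs_alternating_sum_prod_offDiag_le
    (fun p : ι × ι => Real.exp (inner ℝ (u p.1) (u p.2) / (2 * s ^ 2)) - 1)
    (fun _ => Real.exp (r ^ 2 / (2 * s ^ 2)) - 1) fun _ => by
      refine abs_exp_sub_one_le_of_abs_le ?_
      rw [abs_div, abs_of_pos (show 0 < 2 * s ^ 2 by positivity)]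
      gcongr
      refine (abs_real_inner_le_norm _ _).trans ?_
      rw [sq]
      exact mul_le_mul (hu _) (hu _) (norm_nonneg _) hr.le
  simpa using h

theorem integrable_pow_gaussV_div_sub_one_mul (u : V) {s : ℝ} (hs : 0 < s) (k : ℕ) :
    Integrable fun x => (gaussV u s x / gaussV 0 s x - 1) ^ k * gaussV 0 s x := by
  simpa using integrable_prod_gaussV_div_sub_one_mul (fun _ : Fin k => u) hs

theorem integral_pow_gaussV_div_sub_one_mul_le (u : V) {r s : ℝ} (hr : 0 < r) (hs : 0 < s)
    (hu : ‖u‖ ≤ r) (k : ℕ) :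
    ∫ x, (gaussV u s x / gaussV 0 s x - 1) ^ k * gaussV 0 s x ≤ Mcoef (2 * s / r) k := by
  simpa using (le_abs_self _).trans
    (abs_integral_prod_gaussV_div_sub_one_mul_le (fun _ : Fin k => u) hr hs fun _ => hu)

theorem integrable_abs_pow_gaussV_div_sub_one_mul (u : V) {s : ℝ} (hs : 0 < s) (k : ℕ) :
    Integrable fun x => |gaussV u s x / gaussV 0 s x - 1| ^ k * gaussV 0 s x := by
  refine (integrable_pow_gaussV_div_sub_one_mul u hs k).abs.congr
    (Filter.Eventually.of_forall fun x => ?_)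
  simp only [abs_mul, abs_pow, abs_of_pos (gaussV_pos 0 hs x)]

/-- Absolute moments of centred likelihood ratios are bounded by `B̃`. -/
theorem integral_abs_pow_gaussV_div_sub_one_mul_le (u : V) {r s : ℝ} (hr : 0 < r) (hs : 0 < s)
    (hu : ‖u‖ ≤ r) (k : ℕ) :
    ∫ x, |gaussV u s x / gaussV 0 s x - 1| ^ k * gaussV 0 s x ≤ Btil (2 * s / r) k := by
  rw [Btil]
  split_ifs with hk
  · simp_rw [hk.pow_abs]
    exact integral_pow_gaussV_div_sub_one_mul_le u hr hs hu k
  · rw [Nat.not_even_iff_odd] at hk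
    obtain ⟨m, rfl⟩ := hk
    rw [Nat.add_sub_cancel]
    set X : V → ℝ := fun x => gaussV u s x / gaussV 0 s x - 1
    have hP0 : 0 ≤ ∫ x, X x ^ (2 * m) * gaussV 0 s x := integral_nonneg fun x =>
      mul_nonneg ((even_two_mul m).pow_nonneg _) (gaussV_pos 0 hs x).le
    have hQ0 : 0 ≤ ∫ x, X x ^ (2 * m + 1 + 1) * gaussV 0 s x := integral_nonneg fun x =>
      mul_nonneg ((even_two_mul (m + 1)).pow_nonneg _) (gaussV_pos 0 hs x).le
    have hP := integral_pow_gaussV_div_sub_one_mul_le u hr hs hu (2 * m)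
    have hQ := integral_pow_gaussV_div_sub_one_mul_le u hr hs hu (2 * m + 1 + 1)
    have hPi := integrable_pow_gaussV_div_sub_one_mul u hs (2 * m)
    have hQi := integrable_pow_gaussV_div_sub_one_mul u hs (2 * m + 1 + 1)
    have hAi := integrable_abs_pow_gaussV_div_sub_one_mul u hs (2 * m + 1)
    have hquad : ∀ t : ℝ, 0 ≤ (∫ x, X x ^ (2 * m) * gaussV 0 s x) * (t * t) +
        (-2 * ∫ x, |X x| ^ (2 * m + 1) * gaussV 0 s x) * t +
        ∫ x, X x ^ (2 * m + 1 + 1) * gaussV 0 s x := by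
      intro t
      have h : ∫ x, (X x ^ (2 * m) * gaussV 0 s x * (t * t) +
          |X x| ^ (2 * m + 1) * gaussV 0 s x * (-2 * t) +
          X x ^ (2 * m + 1 + 1) * gaussV 0 s x) =
          (∫ x, X x ^ (2 * m) * gaussV 0 s x) * (t * t) +
          (∫ x, |X x| ^ (2 * m + 1) * gaussV 0 s x) * (-2 * t) +
          ∫ x, X x ^ (2 * m + 1 + 1) * gaussV 0 s x := by
        have i1 := hPi.mul_const (t * t)
        have i2 := hAi.mul_const (-2 * t)
        have i12 : Integrable fun x => X x ^ (2 * m) * gaussV 0 s x * (t * t) +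
          |X x| ^ (2 * m + 1) * gaussV 0 s x * (-2 * t) := i1.add i2
        rw [integral_add i12 hQi, integral_add i1 i2, integral_mul_const, integral_mul_const]
      have h0 : 0 ≤ ∫ x, (X x ^ (2 * m) * gaussV 0 s x * (t * t) +
          |X x| ^ (2 * m + 1) * gaussV 0 s x * (-2 * t) +
          X x ^ (2 * m + 1 + 1) * gaussV 0 s x) := by
        refine integral_nonneg fun x => ?_
        have e1 : X x ^ (2 * m) = |X x| ^ (2 * m) := ((even_two_mul m).pow_abs _).symm
        have e2 : X x ^ (2 * m + 1 + 1) = |X x| ^ (2 * m + 1 + 1) :=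
          ((even_two_mul (m + 1)).pow_abs _).symm
        have e3 : X x ^ (2 * m) * gaussV 0 s x * (t * t) +
            |X x| ^ (2 * m + 1) * gaussV 0 s x * (-2 * t) +
            X x ^ (2 * m + 1 + 1) * gaussV 0 s x =
            |X x| ^ (2 * m) * gaussV 0 s x * (t - |X x|) ^ 2 := by
          rw [e1, e2]
          ring
        have := (gaussV_pos (0 : V) hs x).le
        simp only [Pi.zero_apply, e3]
        positivity
      rw [h] at h0
      linarith
    have hd := discrim_le_zero hquad
    rw [discrim] at hd
    refine Real.le_sqrt_of_sq_le ?_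
    have := mul_le_mul hP hQ hQ0 (hP0.trans hP)
    nlinarith

theorem Mcoef_le_Btil {r s : ℝ} (hr : 0 < r) (hs : 0 < s) (k : ℕ) :
    Mcoef (2 * s / r) k ≤ Btil (2 * s / r) k := by
  have hσ : (0 : ℝ) < 2 * s / r / 2 := by positivity
  have h := integral_abs_pow_gaussV_div_sub_one_mul_le (1 : ℝ) one_pos hσ (by simp) k
  have e : 2 * (2 * s / r / 2) / 1 = 2 * s / r := by ring
  rw [e] at h
  refine le_trans ?_ h
  rw [Mcoef]
  simp_rw [gauss1_eq_gaussV]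
  refine integral_mono (integrable_pow_gaussV_div_sub_one_mul 1 hσ k)
    (integrable_abs_pow_gaussV_div_sub_one_mul 1 hσ k) fun x => ?_
  refine mul_le_mul_of_nonneg_right ?_ (gaussV_pos 0 hσ x).le
  rw [← abs_pow]
  exact le_abs_self _

theorem abs_integral_pow_mul_pow_le (u v : V) {r s : ℝ} (hr : 0 < r) (hs : 0 < s)
    (hu : ‖u‖ ≤ r) (hv : ‖v‖ ≤ r) {j k : ℕ} (hj : j ≤ k) :
    |∫ x, (gaussV u s x / gaussV 0 s x - 1) ^ j * (gaussV v s x / gaussV 0 s x - 1) ^ (k - j) *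
      gaussV 0 s x| ≤ Btil (2 * s / r) k := by
  have h := abs_integral_prod_gaussV_div_sub_one_mul_le
    (Sum.elim (fun _ : Fin j => u) (fun _ : Fin (k - j) => v)) hr hs (by
      rintro (a | a) <;> simpa)
  simp only [Fintype.prod_sum_type, Sum.elim_inl, Sum.elim_inr, Finset.prod_const,
    Finset.card_univ, Fintype.card_sum, Fintype.card_fin, Nat.add_sub_cancel' hj] at h
  exact h.trans (Mcoef_le_Btil hr hs k)

theorem integrable_pow_mul_pow (u v : V) {s : ℝ} (hs : 0 < s) (j m : ℕ) :
    Integrable fun x => (gaussV u s x / gaussV 0 s x - 1) ^ j *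
      (gaussV v s x / gaussV 0 s x - 1) ^ m * gaussV 0 s x := by
  simpa [Fintype.prod_sum_type] using integrable_prod_gaussV_div_sub_one_mul
    (Sum.elim (fun _ : Fin j => u) (fun _ : Fin m => v)) hs

theorem integrable_abs_pow_gaussV_ratio (u v : V) {s : ℝ} (hs : 0 < s) (k : ℕ) :
    Integrable fun x => |gaussV u s x / gaussV v s x - 1| ^ k * gaussV v s x := by
  simp_rw [abs_pow_gaussV_div_sub_one_mul_translate u v]
  exact (integrable_abs_pow_gaussV_div_sub_one_mul (u - v) hs k).comp_sub_right v

theorem integral_abs_pow_gaussV_ratio_le (u v : V) {r s : ℝ} (hr : 0 < r) (hs : 0 < s)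
    (huv : ‖u - v‖ ≤ r) (k : ℕ) :
    ∫ x, |gaussV u s x / gaussV v s x - 1| ^ k * gaussV v s x ≤ Btil (2 * s / r) k := by
  simp_rw [abs_pow_gaussV_div_sub_one_mul_translate u v]
  rw [integral_sub_right_eq_self
    (fun y => |gaussV (u - v) s y / gaussV 0 s y - 1| ^ k * gaussV 0 s y)]
  exact integral_abs_pow_gaussV_div_sub_one_mul_le (u - v) hr hs huv k

theorem Btil_nonneg {r s : ℝ} (hr : 0 < r) (hs : 0 < s) (k : ℕ) : 0 ≤ Btil (2 * s / r) k := by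
  refine le_trans (integral_nonneg fun x => ?_)
    (integral_abs_pow_gaussV_div_sub_one_mul_le (0 : ℝ) hr hs (by simpa using hr.le) k)
  have := (gaussV_pos (0 : ℝ) hs x).le
  simp only [Pi.zero_apply]
  positivity

theorem integrable_pow_sub_mul (u v : V) {s : ℝ} (hs : 0 < s) (k : ℕ) :
    Integrable fun x => (gaussV u s x / gaussV 0 s x - gaussV v s x / gaussV 0 s x) ^ k *
      gaussV 0 s x := by
  simp_rw [pow_sub_gaussV_div_mul]
  exact integrable_finsetSum _ fun j _ => (integrable_pow_mul_pow u v hs _ _).const_mul _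

theorem integral_pow_sub_mul (u v : V) {s : ℝ} (hs : 0 < s) (k : ℕ) :
    ∫ x, (gaussV u s x / gaussV 0 s x - gaussV v s x / gaussV 0 s x) ^ k * gaussV 0 s x =
      ∑ j ∈ Finset.range (k + 1), ((-1 : ℝ) ^ (k - j) * (k.choose j : ℝ)) *
        ∫ x, (gaussV u s x / gaussV 0 s x - 1) ^ j *
          (gaussV v s x / gaussV 0 s x - 1) ^ (k - j) * gaussV 0 s x := by
  simp_rw [pow_sub_gaussV_div_mul]
  rw [integral_finsetSum _ fun j _ => (integrable_pow_mul_pow u v hs _ _).const_mul _]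
  simp_rw [integral_const_mul]

theorem integral_pow_sub_mul_le (u v : V) {r s : ℝ} (hr : 0 < r) (hs : 0 < s) (hu : ‖u‖ ≤ r)
    (hv : ‖v‖ ≤ r) (huv : ‖u - v‖ ≤ r) {k : ℕ} (hk : 1 ≤ k) :
    ∫ x, (gaussV u s x / gaussV 0 s x - gaussV v s x / gaussV 0 s x) ^ k * gaussV 0 s x ≤
      (if Even k then 4 else 2) * Btil (2 * s / r) k := by
  have i1 := integrable_abs_pow_gaussV_div_sub_one_mul u hs k
  have i2 := integrable_abs_pow_gaussV_ratio u v hs k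
  have i3 := integrable_abs_pow_gaussV_div_sub_one_mul v hs k
  have i4 := integrable_abs_pow_gaussV_ratio v u hs k
  have b1 := integral_abs_pow_gaussV_div_sub_one_mul_le u hr hs hu k
  have b2 := integral_abs_pow_gaussV_ratio_le u v hr hs huv k
  have b3 := integral_abs_pow_gaussV_div_sub_one_mul_le v hr hs hv k
  have b4 := integral_abs_pow_gaussV_ratio_le v u hr hs (by rwa [norm_sub_rev]) k
  have i12 : Integrable fun x => |gaussV u s x / gaussV 0 s x - 1| ^ k * gaussV 0 s x +
    |gaussV u s x / gaussV v s x - 1| ^ k * gaussV v s x := i1.add i2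
  have i34 : Integrable fun x => |gaussV v s x / gaussV 0 s x - 1| ^ k * gaussV 0 s x +
    |gaussV v s x / gaussV u s x - 1| ^ k * gaussV u s x := i3.add i4
  split_ifs with he
  · have i1234 : Integrable fun x => (|gaussV u s x / gaussV 0 s x - 1| ^ k * gaussV 0 s x +
        |gaussV u s x / gaussV v s x - 1| ^ k * gaussV v s x) +
        (|gaussV v s x / gaussV 0 s x - 1| ^ k * gaussV 0 s x +
        |gaussV v s x / gaussV u s x - 1| ^ k * gaussV u s x) := i12.add i34
    have h := integral_mono (integrable_pow_sub_mul u v hs k) i1234 fun x => by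
      have hu0 := gaussV_pos u hs x
      have hv0 := gaussV_pos v hs x
      have h0 := gaussV_pos (0 : V) hs x
      rcases le_total (gaussV v s x) (gaussV u s x) with hle | hle
      · have := pow_sub_mul_le hv0 h0 hle hk
        have : 0 ≤ |gaussV v s x / gaussV 0 s x - 1| ^ k * gaussV 0 s x +
          |gaussV v s x / gaussV u s x - 1| ^ k * gaussV u s x := by positivity
        linarith
      · have := pow_sub_mul_le hu0 h0 hle hk
        have : 0 ≤ |gaussV u s x / gaussV 0 s x - 1| ^ k * gaussV 0 s x +
          |gaussV u s x / gaussV v s x - 1| ^ k * gaussV v s x := by positivity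
        rw [← neg_sub (gaussV v s x / gaussV 0 s x), he.neg_pow]
        linarith
    rw [integral_add i12 i34, integral_add i1 i2, integral_add i3 i4] at h
    linarith
  · have h := integral_mono (integrable_pow_sub_mul u v hs k) i12 fun x => by
      have hv0 := gaussV_pos v hs x
      have h0 := gaussV_pos (0 : V) hs x
      rcases le_total (gaussV v s x) (gaussV u s x) with hle | hle
      · exact pow_sub_mul_le hv0 h0 hle hk
      · have h1 : gaussV u s x / gaussV 0 s x - gaussV v s x / gaussV 0 s x ≤ 0 :=
          sub_nonpos.mpr (div_le_div_of_nonneg_right hle h0.le)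
        have h2 := (Nat.not_even_iff_odd.mp he).pow_nonpos h1
        have h3 := mul_nonpos_of_nonpos_of_nonneg h2 h0.le
        have : 0 ≤ |gaussV u s x / gaussV 0 s x - 1| ^ k * gaussV 0 s x +
          |gaussV u s x / gaussV v s x - 1| ^ k * gaussV v s x := by positivity
        exact h3.trans this
    rw [integral_add i1 i2] at h
    linarith

end GaussianIntegrals

theorem prod_mul_prod_eq_scaled {α : ℝ} (hα : 1 < α) {j k : ℕ} (hj : j ≤ k) (hk : 1 ≤ k) :
    (∏ ℓ ∈ Finset.range j, (α - (ℓ : ℝ))) * ∏ ℓ ∈ Finset.range (k - j), (α + (ℓ : ℝ) - 1) =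
      (α - 1) * α ^ (k - 1) * (α / (α - 1) * (∏ ℓ ∈ Finset.range j, (1 - (ℓ : ℝ) / α)) *
        ∏ ℓ ∈ Finset.range (k - j), (1 + ((ℓ : ℝ) - 1) / α)) := by
  have h0 : α ≠ 0 := by positivity
  have h1 : α - 1 ≠ 0 := by linarith
  have e1 : ∏ ℓ ∈ Finset.range j, (α - (ℓ : ℝ)) =
      α ^ j * ∏ ℓ ∈ Finset.range j, (1 - (ℓ : ℝ) / α) := by
    rw [← Finset.card_range j, ← Finset.prod_const, Finset.card_range, ← Finset.prod_mul_distrib]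
    refine Finset.prod_congr rfl fun ℓ _ => ?_
    field_simp
  have e2 : ∏ ℓ ∈ Finset.range (k - j), (α + (ℓ : ℝ) - 1) =
      α ^ (k - j) * ∏ ℓ ∈ Finset.range (k - j), (1 + ((ℓ : ℝ) - 1) / α) := by
    rw [← Finset.card_range (k - j), ← Finset.prod_const, Finset.card_range,
      ← Finset.prod_mul_distrib]
    refine Finset.prod_congr rfl fun ℓ _ => ?_
    field_simp
    ring
  have e3 : α ^ j * α ^ (k - j) = α ^ (k - 1) * α := by
    rw [← pow_add, ← pow_succ, Nat.add_sub_cancel' hj, Nat.sub_add_cancel hk]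
  have e4 : (α - 1) * (α / (α - 1)) = α := by field_simp
  rw [e1, e2]
  generalize (∏ ℓ ∈ Finset.range j, (1 - (ℓ : ℝ) / α)) = A
  generalize (∏ ℓ ∈ Finset.range (k - j), (1 + ((ℓ : ℝ) - 1) / α)) = B
  linear_combination (A * B) * e3 - α ^ (k - 1) * A * B * e4

/-- bound on the higher-order Taylor coefficients by `F̃_{α,σ,k}`. -/
theorem stmt16 {pd : ℕ} (r s : ℝ) (hr : 0 < r) (hs : 0 < s) (α : ℝ) (hα : 1 < α)
    (u v : EuclideanSpace ℝ (Fin pd)) (hu : ‖u‖ ≤ r) (hv : ‖v‖ ≤ r) (huv : ‖u - v‖ ≤ r)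
    (k : ℕ) (hk : 3 ≤ k) :
    ∑ j ∈ Finset.range (k + 1),
        (-1 : ℝ) ^ (k - j) * (k.choose j : ℝ) * (∏ ℓ ∈ Finset.range j, (α - (ℓ : ℝ))) *
          (∏ ℓ ∈ Finset.range (k - j), (α + (ℓ : ℝ) - 1)) *
          ∫ θ : EuclideanSpace ℝ (Fin pd),
            (gaussND u s θ / gaussND 0 s θ - 1) ^ j *
              (gaussND v s θ / gaussND 0 s θ - 1) ^ (k - j) * gaussND 0 s θ ≤
      Ftil α (2 * s / r) k := by
  have hk1 : 1 ≤ k := by omega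
  simp_rw [gaussND_eq_gaussV]
  set I : ℕ → ℝ := fun j => ∫ θ : EuclideanSpace ℝ (Fin pd),
    (gaussV u s θ / gaussV 0 s θ - 1) ^ j * (gaussV v s θ / gaussV 0 s θ - 1) ^ (k - j) *
      gaussV 0 s θ
  set c : ℕ → ℝ := fun j => α / (α - 1) * (∏ ℓ ∈ Finset.range j, (1 - (ℓ : ℝ) / α)) *
    (∏ ℓ ∈ Finset.range (k - j), (1 + ((ℓ : ℝ) - 1) / α))
  have hpos : 0 ≤ (α - 1) * α ^ (k - 1) :=
    mul_nonneg (by linarith) (pow_nonneg (by linarith) _)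
  have hsplit : ∑ j ∈ Finset.range (k + 1), (-1 : ℝ) ^ (k - j) * (k.choose j : ℝ) *
      (∏ ℓ ∈ Finset.range j, (α - (ℓ : ℝ))) *
        (∏ ℓ ∈ Finset.range (k - j), (α + (ℓ : ℝ) - 1)) * I j =
      (α - 1) * α ^ (k - 1) *
        ∑ j ∈ Finset.range (k + 1), ((-1 : ℝ) ^ (k - j) * (k.choose j : ℝ)) * I j +
      (α - 1) * α ^ (k - 1) *
        ∑ j ∈ Finset.range (k + 1), (-1 : ℝ) ^ (k - j) * (k.choose j : ℝ) * (c j - 1) * I j := by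
    rw [Finset.mul_sum, Finset.mul_sum, ← Finset.sum_add_distrib]
    refine Finset.sum_congr rfl fun j hj => ?_
    have hjk : j ≤ k := Nat.lt_succ_iff.mp (Finset.mem_range.mp hj)
    have h := prod_mul_prod_eq_scaled hα hjk hk1
    linear_combination (-1 : ℝ) ^ (k - j) * (k.choose j : ℝ) * I j * h
  have hB := Btil_nonneg hr hs k
  have hdiff := integral_pow_sub_mul_le u v hr hs hu hv huv hk1
  rw [integral_pow_sub_mul u v hs] at hdiff
  rw [hsplit, Ftil]
  refine add_le_add (mul_le_mul_of_nonneg_left (hdiff.trans ?_) hpos)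
    (mul_le_mul_of_nonneg_left (Finset.sum_le_sum fun j hj => ?_) hpos)
  · rw [Btil] at hB ⊢
    split_ifs at hB ⊢ <;> linarith
  · have hjk : j ≤ k := Nat.lt_succ_iff.mp (Finset.mem_range.mp hj)
    refine (le_abs_self _).trans ?_
    rw [abs_mul, abs_mul, abs_mul, abs_pow, abs_neg, abs_one, one_pow, one_mul, Nat.abs_cast]
    exact mul_le_mul_of_nonneg_left (abs_integral_pow_mul_pow_le u v hr hs hu hv hjk)
      (by positivity)
end
end

section
/- Let σ > 0, let k ≥ 1 and N ≥ 1 be integers, set a_m = binom(k,m)·N^{−m}·(1 − 1/N)^{k−m} for m = 0,…,k, and let α ≥ 1 be an integer. Then ∫_ℝ ( Σ_{m=0}^{k} a_m · N_{m,σ²/4}(θ)/N_{0,σ²/4}(θ) )^α · N_{0,σ²/4}(θ) dθ = Σ_{m_1,…,m_α = 0}^{k} a_{m_1}···a_{m_α} · exp( (4/σ²)·Σ_{1≤i<j≤α} m_i·m_j ). -/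
open MeasureTheory Finset

noncomputable section

lemma gauss1_eq_gaussianPDFReal (μ s : ℝ) :
    gauss1 μ s = ProbabilityTheory.gaussianPDFReal μ (Real.toNNReal (s ^ 2)) := by
  ext θ
  have hc : (2 * Real.pi * s ^ 2) ^ (-(1 : ℝ) / 2) = (√(2 * Real.pi * s ^ 2))⁻¹ := by
    rw [neg_div, Real.rpow_neg (by positivity), Real.sqrt_eq_rpow]
  rw [gauss1, hc, ProbabilityTheory.gaussianPDFReal, Real.coe_toNNReal _ (sq_nonneg s)]

lemma integrable_gauss1 (μ s : ℝ) : Integrable (gauss1 μ s) := by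
  rw [gauss1_eq_gaussianPDFReal]
  exact ProbabilityTheory.integrable_gaussianPDFReal _ _

lemma integral_gauss1 (μ : ℝ) {s : ℝ} (hs : s ≠ 0) : ∫ θ, gauss1 μ s θ = 1 := by
  rw [gauss1_eq_gaussianPDFReal]
  refine ProbabilityTheory.integral_gaussianPDFReal_eq_one _ ?_
  rw [Ne, Real.toNNReal_eq_zero, not_le]
  positivity

lemma gauss1_div_gauss1_zero (μ : ℝ) {s : ℝ} (hs : s ≠ 0) (θ : ℝ) :
    gauss1 μ s θ / gauss1 0 s θ = Real.exp ((2 * θ * μ - μ ^ 2) / (2 * s ^ 2)) := by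
  have hc : (2 * Real.pi * s ^ 2) ^ (-(1 : ℝ) / 2) ≠ 0 := by positivity
  rw [gauss1, gauss1, mul_div_mul_left _ _ hc, ← Real.exp_sub]
  congr 1
  ring

lemma Fin.sum_sq_eq_sum_sq_add_two_mul {R : Type*} [CommRing R] {n : ℕ} (x : Fin n → R) :
    (∑ i, x i) ^ 2 = ∑ i, x i ^ 2 + 2 * ∑ i, ∑ j ∈ Ioi i, x i * x j := by
  induction n with
  | zero => simp
  | succ n ih =>
    have h := ih fun i => x i.succ
    simp only [Fin.sum_univ_succ, Fin.sum_Ioi_zero, Fin.sum_Ioi_succ, ← mul_sum]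
    simp only [← mul_sum] at h
    linear_combination h

lemma prod_gauss1_div_mul_gauss1_zero {n : ℕ} (μ : Fin n → ℝ) {s : ℝ} (hs : s ≠ 0) (θ : ℝ) :
    (∏ i, gauss1 (μ i) s θ / gauss1 0 s θ) * gauss1 0 s θ =
      Real.exp ((∑ i, ∑ j ∈ Ioi i, μ i * μ j) / s ^ 2) * gauss1 (∑ i, μ i) s θ := by
  simp only [gauss1_div_gauss1_zero _ hs, ← Real.exp_sum, ← sum_div, sum_sub_distrib, ← mul_sum]
  rw [gauss1, gauss1, mul_left_comm, mul_left_comm (Real.exp _), ← Real.exp_add, ← Real.exp_add]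
  congr 2
  have h := Fin.sum_sq_eq_sum_sq_add_two_mul μ
  simp only [← mul_sum] at h ⊢
  field_simp
  linear_combination h

/-- The moments under `N_{0,s²}` of a finite mixture of the likelihood ratios
`N_{μ m,s²} / N_{0,s²}`. -/
lemma integral_mixture_pow_mul_gauss1_zero {ι : Type*} [Fintype ι]
    (a μ : ι → ℝ) {s : ℝ} (hs : s ≠ 0) (n : ℕ) :
    ∫ θ, (∑ m, a m * (gauss1 (μ m) s θ / gauss1 0 s θ)) ^ n * gauss1 0 s θ =
      ∑ f : Fin n → ι, (∏ i, a (f i)) *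
        Real.exp ((∑ i, ∑ j ∈ Ioi i, μ (f i) * μ (f j)) / s ^ 2) := by
  have hexpand (θ : ℝ) :
      (∑ m, a m * (gauss1 (μ m) s θ / gauss1 0 s θ)) ^ n * gauss1 0 s θ =
        ∑ f : Fin n → ι, (∏ i, a (f i)) *
          Real.exp ((∑ i, ∑ j ∈ Ioi i, μ (f i) * μ (f j)) / s ^ 2) *
            gauss1 (∑ i, μ (f i)) s θ := by
    rw [sum_pow', Fintype.piFinset_univ, sum_mul]
    refine sum_congr rfl fun f _ => ?_
    rw [prod_mul_distrib, mul_assoc, prod_gauss1_div_mul_gauss1_zero _ hs, mul_assoc]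
  simp_rw [hexpand]
  rw [integral_finsetSum _ fun f _ => (integrable_gauss1 _ s).const_mul _]
  simp only [integral_const_mul, integral_gauss1 _ hs, mul_one]

/-- exact evaluation of the binomial Gaussian-mixture moment integral. -/
theorem stmt19 (σ : ℝ) (hσ : 0 < σ) (k N : ℕ) (hk : 1 ≤ k) (hN : 1 ≤ N)
    (α : ℕ) (hα : 1 ≤ α) :
    ∫ θ : ℝ,
        (∑ m ∈ Finset.range (k + 1),
            ((k.choose m : ℝ) * ((N : ℝ) ^ m)⁻¹ * (1 - (N : ℝ)⁻¹) ^ (k - m)) *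
              (gauss1 m (σ / 2) θ / gauss1 0 (σ / 2) θ)) ^ α *
          gauss1 0 (σ / 2) θ =
      ∑ f : Fin α → Fin (k + 1),
        (∏ i, ((k.choose (f i : ℕ) : ℝ) * ((N : ℝ) ^ (f i : ℕ))⁻¹ *
            (1 - (N : ℝ)⁻¹) ^ (k - (f i : ℕ)))) *
          Real.exp (4 / σ ^ 2 *
            ∑ i : Fin α, ∑ j ∈ Finset.Ioi i, ((f i : ℕ) : ℝ) * ((f j : ℕ) : ℝ)) := by
  have hs : σ / 2 ≠ 0 := by positivity
  simp only [Finset.sum_range]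
  rw [integral_mixture_pow_mul_gauss1_zero
    (fun m : Fin (k + 1) => (k.choose (m : ℕ) : ℝ) * ((N : ℝ) ^ (m : ℕ))⁻¹ *
      (1 - (N : ℝ)⁻¹) ^ (k - (m : ℕ))) (fun m => ((m : ℕ) : ℝ)) hs]
  refine sum_congr rfl fun f _ => ?_
  congr 2
  field_simp
  norm_num
end
end
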